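/- arXiv:1907.11668 — 7 statements merged into one kernel-verified Lean document; each statement's English description precedes it below -/
import Mathlib

section
/- Let D be a strict digraph of order n ≥ 4 whose minimum degree is at least (3n−3)/2. Then for any two integers s and t with s ≥ 2, t ≥ 2 and s + t ≤ n, D contains two vertex-disjoint directed cycles of orders s and t, respectively. -/
open SimpleGraph

variable {V : Type*}

/-- The degree of `x` in the digraph with arc relation `A`: out-degree plus in-degree. -/
noncomputable def aDeg (A : V → V → Prop) (x : V) : ℕ :=
  Nat.card {y : V // A x y} + Nat.card {y : V // A y x}

/-- `c` is a directed cycle of the digraph with arc relation `A`: a list of at least two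
distinct vertices with an arc between each pair of consecutive vertices and the closing
arc from the last vertex back to the first. -/
def DiCycle (A : V → V → Prop) (c : List V) : Prop :=
  c.Nodup ∧ 2 ≤ c.length ∧ c.Chain' A ∧
    ∀ x y, c.head? = some x → c.getLast? = some y → A y x

open scoped Classical in
/-- The number of arcs between `x` and the vertices of `X`, in either direction, that are absent
from the digraph with arc relation `A`. -/
noncomputable def missingArcs (A : V → V → Prop) (X : Finset V) (x : V) : ℕ :=
  (X.filter fun y => ¬ A x y).card + (X.filter fun y => ¬ A y x).card

/-- The vertices of `X` can be arranged in a directed cycle; a single vertex counts as a cycle. -/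
def SpansCycle (A : V → V → Prop) (X : Finset V) : Prop :=
  ∃ l : List V, l.Nodup ∧ (∀ v, v ∈ l ↔ v ∈ X) ∧
    (l : Cycle V).Chain (fun a b => A a b ∨ a = b)

theorem spansCycle_singleton (A : V → V → Prop) (v : V) : SpansCycle A {v} :=
  ⟨[v], by simp, by simp, by simp⟩

theorem Finset.card_filter_comp_perm {X : Finset V} (τ : Equiv.Perm V)
    (hτ : ∀ c, τ c ∈ X ↔ c ∈ X) (p : V → Prop) [DecidablePred p] :
    (X.filter fun c => p (τ c)).card = (X.filter p).card :=
  Finset.card_equiv τ (by simp [hτ])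

theorem List.exists_isRotated_cons {l : List V} {c : V} (hc : c ∈ l) :
    ∃ l', l ~r (c :: l') := by
  obtain ⟨l₁, l₂, rfl⟩ := List.append_of_mem hc
  exact ⟨l₂ ++ l₁, by simpa using List.isRotated_append (l := l₁) (l' := c :: l₂)⟩

theorem List.exists_isRotated_concat {l : List V} {c : V} (hc : c ∈ l) :
    ∃ l', l ~r (l' ++ [c]) := by
  obtain ⟨l', h⟩ := List.exists_isRotated_cons hc
  exact ⟨l', h.trans (by simpa using List.isRotated_append (l := [c]) (l' := l'))⟩

open scoped Classical in
/-- A vertex that misses fewer than `|X|` arcs to a cycle on `X` can be inserted into it. -/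
theorem SpansCycle.insert_vertex {A : V → V → Prop} {X : Finset V} (hX : SpansCycle A X) {x : V}
    (hx : x ∉ X) (hm : missingArcs A X x < X.card) : SpansCycle A (insert x X) := by
  obtain ⟨l, hnd, hl, hch⟩ := hX
  have hσ : ∀ c, l.formPerm c ∈ X ↔ c ∈ X := fun c => by simp [← hl]
  obtain ⟨c, hcX, hc⟩ : ∃ c ∈ X, c ∉ (X.filter fun c => ¬ A x (l.formPerm c)) ∪
      X.filter fun c => ¬ A c x := by
    apply Finset.exists_mem_notMem_of_card_lt_card
    refine (Finset.card_union_le _ _).trans_lt ?_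
    rwa [Finset.card_filter_comp_perm l.formPerm hσ fun c => ¬ A x c]
  simp only [Finset.mem_union, Finset.mem_filter, hcX, true_and, not_or, not_not] at hc
  obtain ⟨l', hrot⟩ := List.exists_isRotated_concat ((hl c).2 hcX)
  rw [List.formPerm_eq_of_isRotated hnd hrot] at hc
  rw [Cycle.coe_eq_coe.2 hrot] at hch
  have hl' : ∀ v, v ∈ l' ++ [c] ↔ v ∈ X := fun v => by rw [← hrot.mem_iff, hl]
  refine ⟨x :: (l' ++ [c]), ?_, ?_, ?_⟩
  · exact List.nodup_cons.2 ⟨by rwa [hl'], hrot.nodup_iff.1 hnd⟩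
  · intro v
    rw [List.mem_cons, hl', Finset.mem_insert]
  · cases l' with
    | nil => simp_all
    | cons b l'' =>
      rw [List.cons_append, List.formPerm_cons_concat_apply_last] at hc
      simp_all [List.isChain_append, List.isChain_cons]

open scoped Classical in
/-- A vertex outside a cycle can replace each vertex of the cycle, with as many exceptions as it
misses arcs to the cycle. -/
theorem SpansCycle.card_not_replaceable_le {A : V → V → Prop} {X : Finset V}
    (hX : SpansCycle A X) {x : V} (hx : x ∉ X) :
    (X.filter fun c => ¬ SpansCycle A (insert x (X.erase c))).card ≤ missingArcs A X x := by
  obtain ⟨l, hnd, hl, hch⟩ := hX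
  have hσ : ∀ c, l.formPerm c ∈ X ↔ c ∈ X := fun c => by simp [← hl]
  have hσ' : ∀ c, l.formPerm.symm c ∈ X ↔ c ∈ X := fun c => by
    rw [← hσ, Equiv.apply_symm_apply]
  rw [missingArcs, ← Finset.card_filter_comp_perm l.formPerm hσ fun c => ¬ A x c,
    ← Finset.card_filter_comp_perm l.formPerm.symm hσ' fun c => ¬ A c x]
  refine (Finset.card_le_card fun c hc => ?_).trans (Finset.card_union_le _ _)
  obtain ⟨hcX, hc⟩ := Finset.mem_filter.1 hc
  by_contra hgood
  simp only [Finset.mem_union, Finset.mem_filter, hcX, true_and, not_or, not_not] at hgood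
  apply hc
  obtain ⟨l', hrot⟩ := List.exists_isRotated_cons ((hl c).2 hcX)
  rw [List.formPerm_eq_of_isRotated hnd hrot] at hgood
  rw [Cycle.coe_eq_coe.2 hrot] at hch
  have hnd' := hrot.nodup_iff.1 hnd
  have hl' : ∀ v, v ∈ l' ↔ v ∈ X.erase c := fun v => by
    rw [Finset.mem_erase, ← hl, hrot.mem_iff, List.mem_cons]
    have := (List.nodup_cons.1 hnd').1
    constructor
    · exact fun h => ⟨by rintro rfl; exact this h, Or.inr h⟩
    · exact fun h => h.2.resolve_left h.1
  refine ⟨x :: l', ?_, ?_, ?_⟩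
  · exact List.nodup_cons.2
      ⟨fun h => hx (Finset.mem_of_mem_erase ((hl' x).1 h)), (List.nodup_cons.1 hnd').2⟩
  · intro v
    rw [List.mem_cons, hl', Finset.mem_insert]
  · rcases l'.eq_nil_or_concat' with rfl | ⟨l'', d, rfl⟩
    · simp
    · have hd : (c :: (l'' ++ [d])).formPerm.symm c = d := by
        rw [Equiv.symm_apply_eq, List.formPerm_cons_concat_apply_last]
      rw [hd] at hgood
      cases l'' with
      | nil =>
        have hc' : (c :: ([] ++ [d])).formPerm c = d := by simp
        simp_all
      | cons b l₃ =>
        have hb : (c :: (b :: l₃ ++ [d])).formPerm c = b := List.formPerm_apply_head _ _ _ hnd'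
        rw [hb] at hgood
        simp_all [List.isChain_append, List.isChain_cons]

theorem sum_missingArcs_comm (A : V → V → Prop) (X Y : Finset V) :
    ∑ x ∈ X, missingArcs A Y x = ∑ y ∈ Y, missingArcs A X y := by
  simp only [missingArcs, Finset.sum_add_distrib, Finset.card_filter]
  rw [add_comm, Finset.sum_comm, Finset.sum_comm (s := X)]

open scoped Classical in
theorem missingArcs_mono (A : V → V → Prop) {X Y : Finset V} (h : X ⊆ Y) (x : V) :
    missingArcs A X x ≤ missingArcs A Y x :=
  add_le_add (Finset.card_le_card (Finset.filter_subset_filter _ h))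
    (Finset.card_le_card (Finset.filter_subset_filter _ h))

open scoped Classical in
theorem missingArcs_union (A : V → V → Prop) {X Y : Finset V} (h : Disjoint X Y) (x : V) :
    missingArcs A (X ∪ Y) x = missingArcs A X x + missingArcs A Y x := by
  simp only [missingArcs, Finset.filter_union,
    Finset.card_union_of_disjoint (Finset.disjoint_filter_filter h)]
  ring

open scoped Classical in
/-- In a digraph in which every vertex misses at most `(n - 1) / 2` arcs, the first of two disjoint
cycles that do not cover all the vertices can be made longer by one, keeping the length of the
second. -/
theorem exists_disjoint_spansCycle_succ [Fintype V] {A : V → V → Prop}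
    (hA : ∀ x, 2 * missingArcs A (Finset.univ.erase x) x + 1 ≤ Fintype.card V)
    {S T : Finset V} (hS : SpansCycle A S) (hT : SpansCycle A T) (hST : Disjoint S T)
    (hne : S.Nonempty) (hcard : S.card + T.card < Fintype.card V) :
    ∃ S' T' : Finset V, SpansCycle A S' ∧ SpansCycle A T' ∧ Disjoint S' T' ∧
      S'.card = S.card + 1 ∧ T'.card = T.card := by
  by_contra hcon
  have key : ∀ T', SpansCycle A T' → Disjoint S T' → T'.card = T.card →
      ∀ x, x ∉ S → x ∉ T' → S.card ≤ missingArcs A S x := by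
    intro T' hT' hdisj hcard' x hxS hxT
    by_contra! hlt
    exact hcon ⟨insert x S, T', hS.insert_vertex hxS hlt, hT',
      Finset.disjoint_insert_left.2 ⟨hxT, hdisj⟩, Finset.card_insert_of_notMem hxS, hcard'⟩
  obtain ⟨x, hx⟩ : ∃ x, x ∉ S ∪ T := by
    by_contra! hall
    have := Finset.card_le_card (fun x _ => hall x : Finset.univ ⊆ S ∪ T)
    rw [Finset.card_union_of_disjoint hST, Finset.card_univ] at this
    omega
  obtain ⟨hxS, hxT⟩ : x ∉ S ∧ x ∉ T := by simpa using hx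
  set R := T.filter fun c => SpansCycle A (insert x (T.erase c)) with hR
  have hRcard : T.card ≤ R.card + missingArcs A T x := by
    rw [← Finset.card_filter_add_card_filter_not
      (s := T) fun c => SpansCycle A (insert x (T.erase c))]
    exact Nat.add_le_add_left (hT.card_not_replaceable_le hxT) _
  set W := (S ∪ T)ᶜ ∪ R with hW
  have hRT : R ⊆ T := Finset.filter_subset _ _
  have hWS : Disjoint W S := by
    rw [hW, Finset.disjoint_union_left]
    exact ⟨(disjoint_compl_left (a := S ∪ T)).mono_right Finset.subset_union_left,
      hST.symm.mono_left hRT⟩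
  have hWcard : W.card + S.card + T.card = Fintype.card V + R.card := by
    have h1 : W.card = (S ∪ T)ᶜ.card + R.card := Finset.card_union_of_disjoint
      ((disjoint_compl_left (a := S ∪ T)).mono_right (hRT.trans Finset.subset_union_right))
    have h2 := Finset.card_compl_add_card (S ∪ T)
    rw [Finset.card_union_of_disjoint hST] at h2
    omega
  have hlow : ∀ w ∈ W, S.card ≤ missingArcs A S w := by
    intro w hw
    rcases Finset.mem_union.1 hw with hw | hw
    · rw [Finset.mem_compl, Finset.mem_union, not_or] at hw
      exact key T hT hST rfl w hw.1 hw.2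
    · obtain ⟨hwT, hwR⟩ := Finset.mem_filter.1 hw
      have hwx : w ≠ x := by rintro rfl; exact hxT hwT
      refine key _ hwR ?_ ?_ w (Finset.disjoint_right.1 hST hwT) (by simp [hwx])
      · exact Finset.disjoint_insert_right.2 ⟨hxS, hST.mono_right (Finset.erase_subset _ _)⟩
      · rw [Finset.card_insert_of_notMem (by simp [hxT]), Finset.card_erase_add_one hwT]
  have hxm : 2 * (missingArcs A S x + missingArcs A T x) + 1 ≤ Fintype.card V := by
    rw [← missingArcs_union A hST]
    have := missingArcs_mono A (Finset.subset_erase.2 ⟨Finset.subset_univ _, hx⟩) x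
    have := hA x
    omega
  have hsum : 2 * (W.card * S.card) + S.card ≤ S.card * Fintype.card V := by
    have h1 : W.card * S.card ≤ ∑ w ∈ W, missingArcs A S w := by
      simpa using Finset.card_nsmul_le_sum W _ _ hlow
    rw [sum_missingArcs_comm] at h1
    have h2 : ∑ z ∈ S, (2 * missingArcs A W z + 1) ≤ ∑ z ∈ S, Fintype.card V := by
      refine Finset.sum_le_sum fun z hz => le_trans ?_ (hA z)
      have := missingArcs_mono A (Finset.subset_erase.2
        ⟨Finset.subset_univ _, Finset.disjoint_right.1 hWS hz⟩) z
      omega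
    rw [Finset.sum_add_distrib, ← Finset.mul_sum] at h2
    simp only [Finset.sum_const, smul_eq_mul, mul_one] at h2
    omega
  have hW2 : 2 * W.card + 1 ≤ Fintype.card V := by
    refine Nat.le_of_mul_le_mul_left ?_ hne.card_pos
    linarith
  have := key T hT hST rfl x hxS hxT
  omega

open scoped Classical in
theorem exists_disjoint_spansCycle [Fintype V] {A : V → V → Prop}
    (hA : ∀ x, 2 * missingArcs A (Finset.univ.erase x) x + 1 ≤ Fintype.card V)
    (s t : ℕ) (hst : (s + 1) + (t + 1) ≤ Fintype.card V) :
    ∃ S T : Finset V, SpansCycle A S ∧ SpansCycle A T ∧ Disjoint S T ∧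
      S.card = s + 1 ∧ T.card = t + 1 := by
  induction s with
  | zero =>
    induction t with
    | zero =>
      obtain ⟨a, b, hab⟩ := Fintype.exists_pair_of_one_lt_card (α := V) (by omega)
      exact ⟨{a}, {b}, spansCycle_singleton A a, spansCycle_singleton A b, by simpa using hab,
        by simp, by simp⟩
    | succ t ih =>
      obtain ⟨S, T, hS, hT, hST, hs, ht⟩ := ih (by omega)
      obtain ⟨T', S', hT', hS', hST', ht', hs'⟩ := exists_disjoint_spansCycle_succ hA hT hS
        hST.symm (Finset.card_pos.1 (by omega)) (by omega)
      exact ⟨S', T', hS', hT', hST'.symm, by omega, by omega⟩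
  | succ s ih =>
    obtain ⟨S, T, hS, hT, hST, hs, ht⟩ := ih (by omega)
    obtain ⟨S', T', hS', hT', hST', hs', ht'⟩ := exists_disjoint_spansCycle_succ hA hS hT
      hST (Finset.card_pos.1 (by omega)) (by omega)
    exact ⟨S', T', hS', hT', hST', by omega, by omega⟩

theorem List.IsChain.of_or_eq_of_nodup {A : V → V → Prop} {l : List V}
    (h : l.IsChain fun a b => A a b ∨ a = b) (hnd : l.Nodup) : l.IsChain A := by
  induction l with
  | nil => exact List.isChain_nil
  | cons a l ih =>
    rw [List.isChain_cons] at h ⊢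
    refine ⟨fun b hb => (h.1 b hb).resolve_right ?_, ih h.2 (List.nodup_cons.1 hnd).2⟩
    rintro rfl
    exact (List.nodup_cons.1 hnd).1 (List.mem_of_mem_head? hb)

theorem SpansCycle.exists_diCycle {A : V → V → Prop} {X : Finset V} (hX : SpansCycle A X)
    (h2 : 2 ≤ X.card) :
    ∃ c : List V, DiCycle A c ∧ (∀ v, v ∈ c ↔ v ∈ X) ∧ c.length = X.card := by
  classical
  obtain ⟨l, hnd, hl, hch⟩ := hX
  have hlen : l.length = X.card := by
    rw [← List.toFinset_card_of_nodup hnd]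
    congr 1
    ext v
    simp [hl]
  refine ⟨l, ?_, hl, hlen⟩
  rcases l with - | ⟨a, l⟩
  · simp at hlen
    omega
  rw [Cycle.chain_coe_cons, ← List.cons_append, List.isChain_append] at hch
  refine ⟨hnd, by omega, hch.1.of_or_eq_of_nodup hnd, ?_⟩
  intro x y hx hy
  obtain rfl : a = x := by simpa using hx
  refine (hch.2.2 y hy a (by simp)).resolve_right ?_
  rintro rfl
  rcases l.eq_nil_or_concat' with rfl | ⟨l', d, rfl⟩
  · simp at hlen
    omega
  · rw [← List.cons_append, List.getLast?_concat, Option.some_inj] at hy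
    simp [hy] at hnd

open scoped Classical in
theorem aDeg_add_missingArcs [Fintype V] {A : V → V → Prop} (hirr : ∀ x, ¬ A x x) (x : V) :
    aDeg A x + missingArcs A (Finset.univ.erase x) x + 2 = 2 * Fintype.card V := by
  have key : ∀ p : V → Prop, ¬ p x →
      Nat.card {y // p y} + ((Finset.univ.erase x).filter fun y => ¬ p y).card + 1 =
        Fintype.card V := by
    intro p hp
    rw [Nat.card_eq_fintype_card, Fintype.card_subtype, Finset.filter_erase, add_assoc,
      Finset.card_erase_add_one (by simpa using hp), Finset.card_filter_add_card_filter_not,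
      Finset.card_univ]
  have h1 := key (fun y => A x y) (hirr x)
  have h2 := key (fun y => A y x) (hirr x)
  rw [aDeg, missingArcs]
  omega

/-- a strict digraph of order `n ≥ 4` with minimum degree at least
`(3n-3)/2` contains, for any `s, t ≥ 2` with `s + t ≤ n`, two disjoint directed cycles
of orders `s` and `t`.  (`3n ≤ 2·deg + 3` encodes `deg ≥ (3n-3)/2`.) -/
theorem stmt_1 {V : Type*} [Fintype V]
    (A : V → V → Prop) (hirr : ∀ x, ¬ A x x)
    (hn : 4 ≤ Fintype.card V)
    (hdeg : ∀ x : V, 3 * Fintype.card V ≤ 2 * aDeg A x + 3)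
    (s t : ℕ) (hs : 2 ≤ s) (ht : 2 ≤ t) (hst : s + t ≤ Fintype.card V) :
    ∃ c1 c2 : List V, DiCycle A c1 ∧ DiCycle A c2 ∧ c1.Disjoint c2 ∧
      c1.length = s ∧ c2.length = t := by
  classical
  have hA : ∀ x, 2 * missingArcs A (Finset.univ.erase x) x + 1 ≤ Fintype.card V := fun x => by
    have h1 := aDeg_add_missingArcs hirr x
    have h2 := hdeg x
    omega
  obtain ⟨S, T, hS, hT, hST, hSs, hTt⟩ :=
    exists_disjoint_spansCycle hA (s - 1) (t - 1) (by omega)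
  obtain ⟨c1, hc1, hm1, hl1⟩ := hS.exists_diCycle (by omega)
  obtain ⟨c2, hc2, hm2, hl2⟩ := hT.exists_diCycle (by omega)
  refine ⟨c1, c2, hc1, hc2, fun v h1 h2 => ?_, by omega, by omega⟩
  exact Finset.disjoint_left.1 hST ((hm1 v).1 h1) ((hm2 v).1 h2)
end

section
/- Let D be a strict digraph of order n ≥ 4 whose minimum degree is at least (3n−3)/2. Then D contains ⌊n/3⌋ pairwise vertex-disjoint directed triangles (directed cycles of length 3). -/
open SimpleGraph

variable {V : Type*}

/-- `s` is a triple of vertices of total multiplicity at least `w` in the multigraph `μ`. -/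
def IsHeavyTriple (μ : V → V → ℕ) (w : ℕ) (s : Finset V) : Prop :=
  ∃ x y z, x ≠ y ∧ x ≠ z ∧ y ≠ z ∧ (∀ v, v ∈ s ↔ v = x ∨ v = y ∨ v = z) ∧
    w ≤ μ x y + μ x z + μ y z

/-- `F` consists of `k` pairwise disjoint triples, each of total multiplicity at least 5. -/
def IsHeavyPacking (μ : V → V → ℕ) (k : ℕ) (F : Finset (Finset V)) : Prop :=
  F.card = k ∧ (F : Set (Finset V)).PairwiseDisjoint id ∧ ∀ s ∈ F, IsHeavyTriple μ 5 s

theorem IsHeavyTriple.nonempty {μ : V → V → ℕ} {w : ℕ} {s : Finset V}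
    (h : IsHeavyTriple μ w s) : s.Nonempty := by
  obtain ⟨x, y, z, -, -, -, h, -⟩ := h
  exact ⟨x, (h x).2 (Or.inl rfl)⟩

theorem isHeavyTriple_insert [DecidableEq V] {μ : V → V → ℕ} {w : ℕ} {x y z : V}
    (hxy : x ≠ y) (hxz : x ≠ z) (hyz : y ≠ z) (h : w ≤ μ x y + μ x z + μ y z) :
    IsHeavyTriple μ w {x, y, z} :=
  ⟨x, y, z, hxy, hxz, hyz, by simp, h⟩

theorem IsHeavyPacking.insert [DecidableEq V] {μ : V → V → ℕ} {k : ℕ} {F : Finset (Finset V)}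
    (hF : IsHeavyPacking μ k F) {s : Finset V} (hs : IsHeavyTriple μ 5 s)
    (hd : ∀ t ∈ F, Disjoint s t) : IsHeavyPacking μ (k + 1) (insert s F) := by
  obtain ⟨hk, hp, hh⟩ := hF
  have hsF : s ∉ F := fun h => by
    have := hd s h
    simp only [disjoint_self, Finset.bot_eq_empty] at this
    exact hs.nonempty.ne_empty this
  refine ⟨by rw [Finset.card_insert_of_notMem hsF, hk], ?_, ?_⟩
  · rw [Finset.coe_insert]
    exact hp.insert fun t ht _ => hd t ht
  · intro t ht
    rcases Finset.mem_insert.1 ht with rfl | ht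
    exacts [hs, hh t ht]

/-- A triple `{x, y, z}` with a double edge `xy` and a triple of multiplicity at least 5 that are
joined by many edges can be rearranged into two disjoint triples of multiplicity at least 5. -/
theorem exists_disjoint_heavyTriples [DecidableEq V] {μ : V → V → ℕ}
    (hle : ∀ x y, μ x y ≤ 2) {x y z : V} {X T : Finset V}
    (hXT : Disjoint X T) (hX : ∀ v, v ∈ X ↔ v = x ∨ v = y ∨ v = z)
    (hxy : x ≠ y) (hxz : x ≠ z) (hyz : y ≠ z) (hT : IsHeavyTriple μ 5 T)
    (hμxy : μ x y = 2)
    (hsum : 19 ≤ ∑ v ∈ T, (2 * μ z v + μ x v + μ y v)) :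
    ∃ X' T' : Finset V, Disjoint X' T' ∧ X' ∪ T' ⊆ X ∪ T ∧
      IsHeavyTriple μ 5 X' ∧ IsHeavyTriple μ 5 T' := by
  obtain ⟨a, b, c, hab, hac, hbc, hTm, hw⟩ := hT
  have hT' : T = {a, b, c} := by ext v; simp [hTm]
  have hX' : X = {x, y, z} := by ext v; simp [hX]
  subst hT' hX'
  rw [Finset.sum_insert (by simp [hab, hac]), Finset.sum_insert (by simp [hbc]),
    Finset.sum_singleton] at hsum
  have hne : ∀ v ∈ ({x, y, z} : Finset V), ∀ t ∈ ({a, b, c} : Finset V), v ≠ t :=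
    fun v hv t ht h => Finset.disjoint_left.1 hXT hv (h ▸ ht)
  have swap : ∀ u v w p q r : V, ({u, v, w} : Finset V) = {x, y, z} →
      ({p, q, r} : Finset V) = {a, b, c} → u ≠ v → u ≠ w → v ≠ w → p ≠ q → p ≠ r → q ≠ r →
      5 ≤ μ v w + μ v p + μ w p → 5 ≤ μ q r + μ u q + μ u r →
      ∃ X' T' : Finset V, Disjoint X' T' ∧ X' ∪ T' ⊆ {x, y, z} ∪ {a, b, c} ∧
        IsHeavyTriple μ 5 X' ∧ IsHeavyTriple μ 5 T' := by
    intro u v w p q r hX hT huv huw hvw hpq hpr hqr h₁ h₂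
    rw [← hX, ← hT] at hne ⊢
    simp only [Finset.mem_insert, Finset.mem_singleton, forall_eq_or_imp, forall_eq] at hne
    obtain ⟨⟨hup, huq, hur⟩, ⟨hvp, hvq, hvr⟩, hwp, hwq, hwr⟩ := hne
    refine ⟨{v, w, p}, {u, q, r}, ?_, ?_, isHeavyTriple_insert hvw hvp hwp (by omega),
      isHeavyTriple_insert huq hur hqr (by omega)⟩
    · rw [Finset.disjoint_left]
      simp only [Finset.mem_insert, Finset.mem_singleton]
      grind
    · intro v; simp only [Finset.mem_union, Finset.mem_insert, Finset.mem_singleton]; tauto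
  by_contra hcon
  have key : ∀ u v w p q r : V, ({u, v, w} : Finset V) = {x, y, z} →
      ({p, q, r} : Finset V) = {a, b, c} → u ≠ v → u ≠ w → v ≠ w → p ≠ q → p ≠ r → q ≠ r →
      μ v w + μ v p + μ w p ≤ 4 ∨ μ q r + μ u q + μ u r ≤ 4 := by
    intro u v w p q r h₁ h₂ h₃ h₄ h₅ h₆ h₇ h₈
    by_contra! h
    exact hcon (swap u v w p q r h₁ h₂ h₃ h₄ h₅ h₆ h₇ h₈ h.1 h.2)
  have ey : ({y, x, z} : Finset V) = {x, y, z} := Finset.insert_comm _ _ _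
  have ez : ({z, x, y} : Finset V) = {x, y, z} := by ext; simp; tauto
  have eb : ({b, a, c} : Finset V) = {a, b, c} := Finset.insert_comm _ _ _
  have ec : ({c, a, b} : Finset V) = {a, b, c} := by ext; simp; tauto
  have kxa := key x y z a b c rfl rfl hxy hxz hyz hab hac hbc
  have kxb := key x y z b a c rfl eb hxy hxz hyz hab.symm hbc hac
  have kxc := key x y z c a b rfl ec hxy hxz hyz hac.symm hbc.symm hab
  have kya := key y x z a b c ey rfl hxy.symm hyz hxz hab hac hbc
  have kyb := key y x z b a c ey eb hxy.symm hyz hxz hab.symm hbc hac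
  have kyc := key y x z c a b ey ec hxy.symm hyz hxz hac.symm hbc.symm hab
  have kza := key z x y a b c ez rfl hxz.symm hyz.symm hxy hab hac hbc
  have kzb := key z x y b a c ez eb hxz.symm hyz.symm hxy hab.symm hbc hac
  have kzc := key z x y c a b ez ec hxz.symm hyz.symm hxy hac.symm hbc.symm hab
  have := hle x a; have := hle x b; have := hle x c
  have := hle y a; have := hle y b; have := hle y c
  have := hle z a; have := hle z b; have := hle z c
  have := hle a b; have := hle a c; have := hle b c
  clear key swap hcon
  omega

/-- If all but one of the triples of a packing have multiplicity at least 5 and the remaining one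
has multiplicity at least 4, the packing can be repaired. -/
theorem exists_heavyPacking_of_almost [Fintype V] {μ : V → V → ℕ} (hdiag : ∀ x, μ x x = 0)
    (hsymm : ∀ x y, μ x y = μ y x) (hle : ∀ x y, μ x y ≤ 2)
    (hdeg : ∀ x, 3 * Fintype.card V ≤ 2 * ∑ y, μ x y + 3) {k : ℕ} {F : Finset (Finset V)}
    (hk : F.card = k) (hF : (F : Set (Finset V)).PairwiseDisjoint id) {X : Finset V} (hX : X ∈ F)
    (hX4 : IsHeavyTriple μ 4 X) (hF5 : ∀ s ∈ F, s ≠ X → IsHeavyTriple μ 5 s) :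
    ∃ F', IsHeavyPacking μ k F' := by
  classical
  by_contra hcon
  obtain ⟨x, y, z, hxy, hxz, hyz, hXm, hμxy⟩ : ∃ x y z, x ≠ y ∧ x ≠ z ∧ y ≠ z ∧
      (∀ v, v ∈ X ↔ v = x ∨ v = y ∨ v = z) ∧ μ x y = 2 := by
    obtain ⟨x, y, z, hxy, hxz, hyz, hm, hw⟩ := hX4
    have := hle x y; have := hle x z; have := hle y z
    have : μ x y = 2 ∨ μ x z = 2 ∨ μ y z = 2 := by omega
    rcases this with h | h | h
    · exact ⟨x, y, z, hxy, hxz, hyz, hm, h⟩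
    · exact ⟨x, z, y, hxz, hxy, hyz.symm, fun v => by rw [hm]; tauto, h⟩
    · exact ⟨y, z, x, hyz, hxy.symm, hxz.symm, fun v => by rw [hm]; tauto, h⟩
  have hμz : μ x z + μ y z ≤ 2 := by
    by_contra hne
    refine hcon ⟨F, hk, hF, fun s hs => ?_⟩
    by_cases h : s = X
    · exact ⟨x, y, z, hxy, hxz, hyz, h ▸ hXm, by omega⟩
    · exact hF5 s hs h
  have hpack : ∀ G ⊆ F, X ∉ G → IsHeavyPacking μ G.card G := fun G hG hXG =>
    ⟨rfl, hF.subset (by exact_mod_cast hG), fun s hs => hF5 s (hG hs) fun h => hXG (h ▸ hs)⟩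
  have hXsum : ∑ v ∈ X, (2 * (μ z v : ℤ) + μ x v + μ y v - 6) ≤ -8 := by
    have : X = {x, y, z} := by ext v; simp [hXm]
    rw [this, Finset.sum_insert (by simp [hxy, hxz]), Finset.sum_insert (by simp [hyz]),
      Finset.sum_singleton, hdiag, hdiag, hdiag, hsymm y x, hsymm z x, hsymm z y]
    push_cast
    omega
  have hTsum : ∀ T ∈ F.erase X, ∑ v ∈ T, (2 * (μ z v : ℤ) + μ x v + μ y v - 6) ≤ 0 := by
    intro T hT
    obtain ⟨hTX, hTF⟩ := Finset.mem_erase.1 hT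
    by_contra! hpos
    have hT5 := hF5 T hTF hTX
    have hcard : T.card = 3 := by
      obtain ⟨a, b, c, hab, hac, hbc, hm, -⟩ := hT5
      exact Finset.card_eq_three.2 ⟨a, b, c, hab, hac, hbc, by ext v; simp [hm]⟩
    have h19 : 19 ≤ ∑ v ∈ T, (2 * μ z v + μ x v + μ y v) := by
      rw [Finset.sum_sub_distrib, Finset.sum_const, hcard] at hpos
      zify
      simp at hpos ⊢
      omega
    obtain ⟨X', T', hd, hsub, hX', hT'⟩ := exists_disjoint_heavyTriples hle
      (hF hX hTF hTX.symm) hXm hxy hxz hyz hT5 hμxy h19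
    have hG := hpack ((F.erase X).erase T)
      ((Finset.erase_subset _ _).trans (Finset.erase_subset _ _)) (by simp)
    have hdis : ∀ s ∈ (F.erase X).erase T, Disjoint (X' ∪ T') s := by
      intro s hs
      simp only [Finset.mem_erase] at hs
      refine Disjoint.mono_left hsub (Finset.disjoint_union_left.2 ⟨?_, ?_⟩)
      · exact hF hX hs.2.2 hs.2.1.symm
      · exact hF hTF hs.2.2 hs.1.symm
    have h2 := (hG.insert hT' fun s hs =>
      (Finset.disjoint_union_left.1 (hdis s hs)).2).insert hX' (by
        intro s hs
        rcases Finset.mem_insert.1 hs with rfl | hs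
        exacts [hd, (Finset.disjoint_union_left.1 (hdis s hs)).1])
    rw [Finset.card_erase_add_one hT, Finset.card_erase_add_one hX, hk] at h2
    exact hcon ⟨_, h2⟩
  have hrest : ∀ v ∈ (F.biUnion id)ᶜ, 2 * (μ z v : ℤ) + μ x v + μ y v - 6 ≤ 0 := by
    intro v hv
    have hv' : ∀ s ∈ F, v ∉ s := by simpa using hv
    by_contra! hpos
    have := hle z v
    have hvX := hv' X hX
    rw [hXm] at hvX
    push Not at hvX
    have hs : IsHeavyTriple μ 5 {x, y, v} :=
      isHeavyTriple_insert hxy hvX.1.symm hvX.2.1.symm (by omega)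
    have h1 := (hpack (F.erase X) (Finset.erase_subset _ _) (by simp)).insert hs (by
      intro s hs
      obtain ⟨hsX, hsF⟩ := Finset.mem_erase.1 hs
      have hd : Disjoint X s := hF hX hsF hsX.symm
      have hx := Finset.disjoint_left.1 hd ((hXm x).2 (by simp))
      have hy := Finset.disjoint_left.1 hd ((hXm y).2 (by simp))
      simp [hx, hy, hv' s hsF])
    rw [Finset.card_erase_add_one hX, hk] at h1
    exact hcon ⟨_, h1⟩
  have htotal : ∑ v, (2 * (μ z v : ℤ) + μ x v + μ y v - 6) ≤ -8 := by
    rw [← Finset.sum_add_sum_compl (F.biUnion id), Finset.sum_biUnion hF,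
      ← Finset.add_sum_erase _ _ hX]
    have h₁ := Finset.sum_nonpos hTsum
    have h₂ := Finset.sum_nonpos hrest
    simp only [id] at *
    omega
  have hx := hdeg x; have hy := hdeg y; have hz := hdeg z
  simp only [Finset.sum_sub_distrib, Finset.sum_add_distrib, ← Finset.mul_sum, Finset.sum_const,
    Finset.card_univ, ← Nat.cast_sum, nsmul_eq_mul] at htotal
  omega

/-- A multigraph with multiplicities at most 2 and minimum degree at least `(3n-3)/2` has
`⌊n/3⌋` disjoint triples of multiplicity at least 5. -/
theorem exists_heavyPacking [Fintype V] (μ : V → V → ℕ) (hdiag : ∀ x, μ x x = 0)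
    (hsymm : ∀ x y, μ x y = μ y x) (hle : ∀ x y, μ x y ≤ 2)
    (hdeg : ∀ x, 3 * Fintype.card V ≤ 2 * ∑ y, μ x y + 3) :
    ∃ F, IsHeavyPacking μ (Fintype.card V / 3) F := by
  classical
  induction hd : ∑ x, ∑ y, (2 - μ x y) using Nat.strong_induction_on generalizing μ with
  | _ d ih =>
  by_cases hfull : ∀ x y, x ≠ y → μ x y = 2
  · have hex : ∀ k, 3 * k ≤ Fintype.card V →
        ∃ F, IsHeavyPacking μ k F ∧ (F.biUnion id).card ≤ 3 * k := by
      intro k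
      induction k with
      | zero => exact fun _ => ⟨∅, by simp [IsHeavyPacking]⟩
      | succ k ihk =>
        intro hk
        obtain ⟨F, hF, hc⟩ := ihk (by omega)
        obtain ⟨s, hs, hs3⟩ := Finset.exists_subset_card_eq
          (s := (F.biUnion id)ᶜ) (n := 3) (by rw [Finset.card_compl]; omega)
        have hs5 : IsHeavyTriple μ 5 s := by
          obtain ⟨a, b, c, hab, hac, hbc, rfl⟩ := Finset.card_eq_three.1 hs3
          exact isHeavyTriple_insert hab hac hbc
            (by rw [hfull _ _ hab, hfull _ _ hac, hfull _ _ hbc]; norm_num)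
        refine ⟨_, hF.insert hs5 fun t ht => ?_, ?_⟩
        · exact Finset.disjoint_left.2 fun v hv hvt =>
            Finset.mem_compl.1 (hs hv) (Finset.mem_biUnion.2 ⟨t, ht, hvt⟩)
        · rw [Finset.biUnion_insert]
          refine (Finset.card_union_le _ _).trans ?_
          simp only [id] at *
          omega
    obtain ⟨F, hF, -⟩ := hex (Fintype.card V / 3) (Nat.mul_div_le _ _)
    exact ⟨F, hF⟩
  push Not at hfull
  obtain ⟨p, q, hpq, hμpq⟩ := hfull
  let ν : V → V → ℕ := fun x y => μ x y + if (x = p ∧ y = q) ∨ (x = q ∧ y = p) then 1 else 0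
  have hμν : ∀ x y, μ x y ≤ ν x y := fun x y => Nat.le_add_right _ _
  have hνp : ν p q = μ p q + 1 := by simp [ν]
  have hν : ∀ x y, ¬((x = p ∧ y = q) ∨ (x = q ∧ y = p)) → ν x y = μ x y :=
    fun x y h => by simp only [ν, if_neg h, add_zero]
  have hνsymm : ∀ x y, ν x y = ν y x := by
    intro x y
    simp only [ν, hsymm x y]
    congr 2
    exact propext (by tauto)
  have hνle : ∀ x y, ν x y ≤ 2 := by
    intro x y
    have := hle x y
    have := hle p q
    have := hsymm p q
    simp only [ν]
    split_ifs with h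
    · rcases h with ⟨rfl, rfl⟩ | ⟨rfl, rfl⟩ <;> omega
    · omega
  obtain ⟨F, hk, hF, hF5⟩ := ih (∑ x, ∑ y, (2 - ν x y)) (by
      rw [← hd]
      refine Finset.sum_lt_sum
        (fun x _ => Finset.sum_le_sum fun y _ => Nat.sub_le_sub_left (hμν x y) 2)
        ⟨p, Finset.mem_univ _, Finset.sum_lt_sum
          (fun y _ => Nat.sub_le_sub_left (hμν p y) 2) ⟨q, Finset.mem_univ _, ?_⟩⟩
      have := hle p q
      omega) ν
    (fun x => by rw [hν, hdiag]; rintro (⟨rfl, rfl⟩ | ⟨rfl, rfl⟩) <;> exact hpq rfl)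
    hνsymm hνle
    (fun x => (hdeg x).trans (by gcongr with y; exact hμν x y)) rfl
  have hcases : ∀ s ∈ F, IsHeavyTriple μ 5 s ∨ (IsHeavyTriple μ 4 s ∧ p ∈ s ∧ q ∈ s) := by
    intro s hs
    obtain ⟨x, y, z, hxy, hxz, hyz, hm, hw⟩ := hF5 s hs
    by_cases hpqs : p ∈ s ∧ q ∈ s
    · refine Or.inr ⟨⟨x, y, z, hxy, hxz, hyz, hm, ?_⟩, hpqs⟩
      simp only [ν] at hw
      split_ifs at hw <;> first | omega | grind
    · refine Or.inl ⟨x, y, z, hxy, hxz, hyz, hm, ?_⟩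
      rw [hm, hm] at hpqs
      rwa [hν x y (by grind), hν x z (by grind), hν y z (by grind)] at hw
  by_cases hall : ∀ s ∈ F, IsHeavyTriple μ 5 s
  · exact ⟨F, hk, hF, hall⟩
  push Not at hall
  obtain ⟨X, hX, hX5⟩ := hall
  obtain ⟨hX4, hpX, hqX⟩ := (hcases X hX).resolve_left hX5
  refine exists_heavyPacking_of_almost hdiag hsymm hle hdeg hk hF hX hX4 fun s hs hsX => ?_
  refine (hcases s hs).resolve_right fun h => ?_
  exact Finset.disjoint_left.1 (hF hs hX hsX) h.2.1 hpX

/-- Three vertices carrying at least 5 of the 6 possible arcs span a directed triangle. -/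
theorem exists_diCycle_of_heavyTriple [DecidableEq V] {A : V → V → Prop} [DecidableRel A]
    {s : Finset V}
    (hs : IsHeavyTriple (fun x y => (if A x y then 1 else 0) + if A y x then 1 else 0) 5 s) :
    ∃ c : List V, DiCycle A c ∧ c.length = 3 ∧ ∀ v ∈ c, v ∈ s := by
  obtain ⟨x, y, z, hxy, hxz, hyz, hm, hw⟩ := hs
  have : (A x y ∧ A y z ∧ A z x) ∨ (A x z ∧ A z y ∧ A y x) := by
    by_contra h
    grind
  rcases this with h | h
  · refine ⟨[x, y, z], ?_, rfl, by simp [hm]⟩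
    simp [DiCycle, List.Chain', *]
  · refine ⟨[x, z, y], ?_, rfl, by simp [hm]⟩
    simp [DiCycle, List.Chain', *, hyz.symm]

/-- a strict digraph of order `n ≥ 4` with minimum degree at least
`(3n-3)/2` contains `⌊n/3⌋` pairwise disjoint directed triangles. -/
theorem stmt_2 {V : Type*} [Fintype V]
    (A : V → V → Prop) (hirr : ∀ x, ¬ A x x)
    (hn : 4 ≤ Fintype.card V)
    (hdeg : ∀ x : V, 3 * Fintype.card V ≤ 2 * aDeg A x + 3) :
    ∃ T : List (List V), T.length = Fintype.card V / 3 ∧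
      (∀ c ∈ T, DiCycle A c ∧ c.length = 3) ∧ T.Pairwise List.Disjoint := by
  classical
  obtain ⟨F, hk, hF, hF5⟩ := exists_heavyPacking
    (fun x y => (if A x y then 1 else 0) + if A y x then 1 else 0)
    (fun x => by simp [hirr]) (fun x y => add_comm _ _) (fun x y => by split_ifs <;> norm_num)
    (fun x => by
      have h : aDeg A x = ∑ y, ((if A x y then 1 else 0) + if A y x then 1 else 0) := by
        rw [Finset.sum_add_distrib, aDeg, Nat.card_eq_fintype_card, Nat.card_eq_fintype_card,
          Fintype.card_subtype, Fintype.card_subtype, Finset.card_filter, Finset.card_filter]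
      exact h ▸ hdeg x)
  have hex : ∀ s, ∃ c : List V, s ∈ F → DiCycle A c ∧ c.length = 3 ∧ ∀ v ∈ c, v ∈ s := fun s =>
    if hs : s ∈ F then (exists_diCycle_of_heavyTriple (hF5 s hs)).imp fun _ h _ => h
    else ⟨[], fun h => absurd h hs⟩
  choose c hc using hex
  refine ⟨F.toList.map c, by simp [hk], ?_, ?_⟩
  · intro d hd
    obtain ⟨s, hs, rfl⟩ := List.mem_map.1 hd
    have := hc s (Finset.mem_toList.1 hs)
    exact ⟨this.1, this.2.1⟩
  · rw [List.pairwise_map]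
    refine F.nodup_toList.imp_of_mem fun {s t} hs ht hst v hvs hvt => ?_
    rw [Finset.mem_toList] at hs ht
    exact Finset.disjoint_left.1 (hF hs ht hst) ((hc s hs).2.2 v hvs) ((hc t ht).2.2 v hvt)
end

section
/- Let G be a simple graph, let P = x1 x2 … xk be a path of G, and let y ∈ V(G) − V(P). If d(y, V(P)) > k/2, then {x_i, x_{i+1}} ⊆ N(y) for some i ∈ {1, 2, …, k−1}, unless k is odd, d(y, V(P)) = (k+1)/2 and N(y) ∩ V(P) = {x1, x3, x5, …, x_k}. -/
open SimpleGraph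

variable {V : Type*}

/-- `d(x, S)`: the number of neighbours of `x` (in the graph `G`) lying in `S`. -/
noncomputable def dOn (G : SimpleGraph V) (x : V) (S : Set V) : ℕ :=
  Nat.card {y : V // y ∈ S ∧ G.Adj x y}

/-- A graph is traceable if it has a Hamiltonian path. -/
def Traceable {α : Type*} (H : SimpleGraph α) : Prop :=
  ∃ (a b : α) (p : H.Walk a b), p.IsPath ∧ ∀ x, x ∈ p.support

/-- If no two consecutive numbers below `n` satisfy `P`, then at most `(n + 1) / 2` numbers below
`n` satisfy `P`, with equality for odd `n` only if they are exactly the even ones. -/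
theorem two_mul_count_le_of_no_consecutive (P : ℕ → Prop) [DecidablePred P] (n : ℕ)
    (h : ∀ i, i + 1 < n → P i → ¬ P (i + 1)) :
    2 * Nat.count P n ≤ n + 1 ∧
      (2 * Nat.count P n = n + 1 → ∀ i < n, (P i ↔ Even i)) := by
  induction n using Nat.twoStepInduction with
  | zero => simp
  | one =>
    by_cases h0 : P 0 <;> simp [Nat.count_succ, h0]
  | more n ih _ =>
    obtain ⟨hle, heq⟩ := ih fun i hi => h i (by omega)
    have hn := h n (by omega)
    rw [Nat.count_succ, Nat.count_succ]
    refine ⟨by split_ifs <;> first | omega | tauto, fun hc => ?_⟩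
    have hcn : 2 * Nat.count P n = n + 1 := by
      split_ifs at hc <;> first | omega | tauto
    have hall := heq hcn
    obtain ⟨m, rfl⟩ : ∃ m, n = m + 1 := ⟨n - 1, by omega⟩
    have hm : Even m := by
      rw [Nat.even_iff]; omega
    have hP : ¬ P (m + 1) := h m (by omega) ((hall m (by omega)).2 hm)
    have hP' : P (m + 1 + 1) := by
      by_contra hP'
      simp only [hP, hP', if_false] at hc
      omega
    intro i hi
    obtain hi | rfl | rfl : i < m + 1 ∨ i = m + 1 ∨ i = m + 1 + 1 := by omega
    · exact hall i hi
    · simp [hP, Nat.even_add_one, hm]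
    · simp [hP', hm]

/-- The neighbours of `y` on a duplicate-free list are counted by their positions. -/
theorem dOn_eq_count (G : SimpleGraph V) (y : V) (l : List V) (hl : l.Nodup)
    [DecidablePred fun i => G.Adj y (l.getD i y)] :
    dOn G y {v | v ∈ l} = Nat.count (fun i => G.Adj y (l.getD i y)) l.length := by
  classical
  rw [Nat.count_eq_card_filter_range]
  have hinj : Set.InjOn (fun i => l.getD i y)
      ((Finset.range l.length).filter fun i => G.Adj y (l.getD i y) : Finset ℕ) := by
    intro i hi j hj hij
    simp only [Finset.coe_filter, Finset.mem_range, Set.mem_ofPred_eq] at hi hj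
    simp only [List.getD_eq_getElem _ _ hi.1, List.getD_eq_getElem _ _ hj.1] at hij
    exact (hl.getElem_inj_iff).1 hij
  rw [← Finset.card_image_of_injOn hinj, dOn]
  refine Nat.subtype_card _ fun v => ?_
  simp only [Finset.mem_image, Finset.mem_filter, Finset.mem_range, Set.mem_ofPred_eq]
  constructor
  · rintro ⟨i, ⟨hi, hadj⟩, rfl⟩
    exact ⟨by rw [List.getD_eq_getElem _ _ hi]; exact List.getElem_mem hi, hadj⟩
  · rintro ⟨hv, hadj⟩
    obtain ⟨i, hi, rfl⟩ := List.getElem_of_mem hv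
    exact ⟨i, ⟨hi, by rwa [List.getD_eq_getElem _ _ hi]⟩, List.getD_eq_getElem _ _ hi⟩

/-- Lemma 2.1(a): if `P = x₁…x_k` is a path of `G`, `y ∉ V(P)` and
`d(y, V(P)) > k/2`, then `y` is adjacent to two consecutive vertices of `P`, unless
`k` is odd, `d(y, V(P)) = (k+1)/2`, and the neighbours of `y` on `P` are exactly
`x₁, x₃, x₅, …, x_k`.  Here `p.support = [x₁, …, x_k]` and `p.support.getD i y` is
`x_{i+1}` (0-based indexing). -/
theorem stmt_4 {V : Type*} (G : SimpleGraph V) {a b : V}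
    (p : G.Walk a b) (hp : p.IsPath) (y : V) (hy : y ∉ p.support)
    (hd : p.support.length < 2 * dOn G y {v | v ∈ p.support}) :
    (∃ i : ℕ, i + 1 < p.support.length ∧
        G.Adj y (p.support.getD i y) ∧ G.Adj y (p.support.getD (i + 1) y)) ∨
    (Odd p.support.length ∧
      2 * dOn G y {v | v ∈ p.support} = p.support.length + 1 ∧
      ∀ i < p.support.length, (G.Adj y (p.support.getD i y) ↔ Even i)) := by
  classical
  rw [dOn_eq_count G y p.support hp.support_nodup] at hd ⊢
  refine or_iff_not_imp_left.2 fun hno => ?_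
  push Not at hno
  obtain ⟨hle, heq⟩ := two_mul_count_le_of_no_consecutive
    (fun i => G.Adj y (p.support.getD i y)) p.support.length hno
  have hc := le_antisymm hle hd
  exact ⟨by rw [Nat.odd_iff]; omega, hc, heq hc⟩
end

section
/- Let G be a simple graph, let P = x1 x2 … xk be a path of G, and let y ∈ V(G) − V(P). If d(y, V(P)) ≥ k/2, then the induced subgraph G[V(P) ∪ {y}] is traceable (it has a Hamiltonian path). -/
open SimpleGraph

variable {V : Type*}

open Classical in
/-- Cardinality bound for the neighbours of `y` among the entries of a list. -/
lemma dOn_le_countP (G : SimpleGraph V) (y : V) (l : List V) :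
    dOn G y {v | v ∈ l} ≤ l.countP (fun v => G.Adj y v) := by
  have h : dOn G y {v | v ∈ l} = (l.filter (fun v => G.Adj y v)).toFinset.card := by
    rw [dOn]
    exact Nat.subtype_card _ (by simp)
  rw [h, List.countP_eq_length_filter]
  exact List.toFinset_card_le _

open Classical in
/-- Either `y` can be inserted into the walk `p` after its first vertex, or at most about half of
the vertices of `p` are adjacent to `y`. -/
lemma SimpleGraph.Walk.exists_support_perm_cons_or_countP_le {G : SimpleGraph V} (y : V) {a b : V}
    (p : G.Walk a b) :
    (∃ (c : V) (q : G.Walk a c), q.support.Perm (y :: p.support)) ∨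
      2 * p.support.countP (fun v => G.Adj y v) + (if G.Adj y a then 0 else 1) ≤
        p.support.length := by
  induction p with
  | @nil a =>
    by_cases h : G.Adj y a
    · exact Or.inl ⟨y, .cons h.symm .nil, by simpa using List.Perm.swap _ _ _⟩
    · right
      simp [h]
  | @cons a c b hac p ih =>
    by_cases h : G.Adj y a ∧ G.Adj y c
    · exact Or.inl ⟨b, .cons h.1.symm (.cons h.2 p), by simpa using List.Perm.swap _ _ _⟩
    obtain ⟨d, q, hq⟩ | ih := ih
    · refine Or.inl ⟨d, .cons hac q, ?_⟩
      simpa using (hq.cons a).trans (List.Perm.swap _ _ _)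
    · right
      simp only [Walk.support_cons, List.countP_cons, List.length_cons, decide_eq_true_eq]
      split_ifs at ih ⊢ <;> first | omega | tauto

/-- A walk visiting every vertex of `s` exactly once makes the subgraph induced on `s` traceable. -/
lemma SimpleGraph.Walk.IsPath.traceable_induce {G : SimpleGraph V} {a b : V} {q : G.Walk a b}
    (hq : q.IsPath) {s : Set V} (hs : ∀ x, x ∈ q.support ↔ x ∈ s) : Traceable (G.induce s) := by
  have h : ∀ x ∈ q.support, x ∈ s := fun x => (hs x).1
  refine ⟨_, _, q.induce s h, ?_, ?_⟩
  · apply Walk.IsPath.of_map (f := (Embedding.induce s).toHom)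
    rwa [Walk.map_induce]
  · intro x
    rw [Walk.support_induce]
    simpa using (hs x).2 x.2

/-- Lemma 2.1(b): if `P` is a path of `G` on `k` vertices, `y ∉ V(P)` and
`d(y, V(P)) ≥ k/2`, then the induced subgraph `G[V(P) ∪ {y}]` is traceable. -/
theorem stmt_5 {V : Type*} (G : SimpleGraph V) {a b : V}
    (p : G.Walk a b) (hp : p.IsPath) (y : V) (hy : y ∉ p.support)
    (hd : p.support.length ≤ 2 * dOn G y {v | v ∈ p.support}) :
    Traceable (G.induce (insert y {v | v ∈ p.support})) := by
  classical
  obtain ⟨c, d, q, hq⟩ : ∃ (c d : V) (q : G.Walk c d), q.support.Perm (y :: p.support) := by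
    by_cases hya : G.Adj y a
    · exact ⟨y, b, .cons hya p, by simp⟩
    obtain ⟨d, q, hq⟩ | h := p.exists_support_perm_cons_or_countP_le y
    · exact ⟨a, d, q, hq⟩
    · have := dOn_le_countP G y p.support
      rw [if_neg hya] at h
      omega
  have hq' : q.IsPath :=
    (Walk.isPath_def q).2 (hq.nodup_iff.2 (List.nodup_cons.2 ⟨hy, hp.support_nodup⟩))
  exact hq'.traceable_induce fun x => by simp [hq.mem_iff]
end

section
/- Let G be a simple graph, let P = x1 x2 … xk be a path of G, and let y ∈ V(G) − V(P). If d(x1, V(P)) + d(y, V(P)) ≥ k, then the induced subgraph G[V(P) ∪ {y}] is traceable (it has a Hamiltonian path). -/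
open SimpleGraph

variable {V : Type*}

theorem List.exists_consecutive_of_length_le_countP {α : Type*} (p q : α → Bool) :
    ∀ (u : α) (l : List α), q ((u :: l).getLast (by simp)) = false →
      (u :: l).length ≤ l.countP p + (u :: l).countP q →
      ∃ s v w t, u :: l = s ++ v :: w :: t ∧ q v = true ∧ p w = true
  | u, [], hq, h => by simp_all
  | u, v :: l, hq, h => by
    by_cases huv : q u = true ∧ p v = true
    · exact ⟨[], u, v, l, rfl, huv⟩
    · have hlen : (v :: l).length ≤ l.countP p + (v :: l).countP q := by
        simp only [List.countP_cons, List.length_cons] at h ⊢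
        grind
      obtain ⟨s, x, w, t, hs, hx⟩ := exists_consecutive_of_length_le_countP p q v l
        (by simpa using hq) hlen
      exact ⟨u :: s, x, w, t, by simp [hs], hx⟩

theorem dOn_eq_countP {V : Type*} (G : SimpleGraph V) [DecidableRel G.Adj] (x : V)
    {l : List V} (hl : l.Nodup) :
    dOn G x {v | v ∈ l} = l.countP (fun v => decide (G.Adj x v)) := by
  classical
  rw [dOn, Nat.subtype_card (l.filter (fun v => decide (G.Adj x v))).toFinset (by simp),
    List.toFinset_card_of_nodup (hl.filter _), List.countP_eq_length_filter]

theorem traceable_induce_of_isChain {V : Type*} (G : SimpleGraph V) {S : Set V} {l : List V}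
    (hne : l ≠ []) (hc : l.IsChain G.Adj) (hl : l.Nodup) (hS : ∀ x, x ∈ l ↔ x ∈ S) :
    Traceable (G.induce S) := by
  have hsupp := Walk.support_ofSupport hne hc
  refine ⟨_, _, (Walk.ofSupport l hne hc).induce S (fun x hx => (hS x).1 (hsupp ▸ hx)), ?_, ?_⟩
  · rw [Walk.isPath_def, Walk.support_induce]
    refine List.Nodup.of_map Subtype.val ?_
    rwa [List.attachWith_map_subtype_val, hsupp]
  · rintro ⟨x, hx⟩
    rw [Walk.support_induce, List.mem_attachWith, hsupp]
    exact (hS x).2 hx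

/-- Lemma 2.1(c): if `P = x₁…x_k` is a path of `G` from `a = x₁`,
`y ∉ V(P)` and `d(x₁, V(P)) + d(y, V(P)) ≥ k`, then `G[V(P) ∪ {y}]` is traceable. -/
theorem stmt_6 {V : Type*} (G : SimpleGraph V) {a b : V}
    (p : G.Walk a b) (hp : p.IsPath) (y : V) (hy : y ∉ p.support)
    (hd : p.support.length ≤
      dOn G a {v | v ∈ p.support} + dOn G y {v | v ∈ p.support}) :
    Traceable (G.induce (insert y {v | v ∈ p.support})) := by
  classical
  rw [dOn_eq_countP G a hp.support_nodup, dOn_eq_countP G y hp.support_nodup] at hd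
  have hc := p.isChain_adj_support
  have hn := hp.support_nodup
  by_cases hyb : G.Adj y b
  · refine traceable_induce_of_isChain G (l := y :: p.support.reverse) (by simp) ?_ ?_ ?_
    · rw [List.isChain_cons]
      refine ⟨by simpa [List.head?_reverse, List.getLast?_eq_some_getLast p.support_ne_nil]
        using hyb, ?_⟩
      rw [List.isChain_reverse]
      exact hc.imp fun _ _ h => h.symm
    · simp [hy, hn]
    · simp
  · have hsupp := p.cons_tail_support.symm
    have hlast : p.support.getLast? = some b := by
      rw [List.getLast?_eq_some_getLast p.support_ne_nil, p.getLast_support]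
    generalize p.support.tail = l at hsupp
    rw [hsupp] at hy hd hc hn hlast ⊢
    obtain ⟨s, u, v, t, hs, hu, hv⟩ :=
      List.exists_consecutive_of_length_le_countP
      (fun v => decide (G.Adj a v)) (fun v => decide (G.Adj y v)) a l
      (by simpa [(List.getLast_eq_iff_getLast?_eq_some _).2 hlast] using hyb)
      (by simpa [List.countP_cons] using hd)
    have hhead : (s ++ [u]).head? = some a := by
      cases s <;> simp_all
    rw [hs] at hy hc hn ⊢
    rw [List.isChain_append_cons_cons] at hc
    refine traceable_induce_of_isChain G (l := y :: ((s ++ [u]).reverse ++ v :: t)) (by simp)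
      ?_ ?_ ?_
    · rw [List.isChain_cons, List.isChain_append, List.isChain_reverse,
        List.getLast?_reverse, hhead]
      refine ⟨by simpa using hu, hc.1.imp fun _ _ h => h.symm, hc.2.2, by simpa using hv⟩
    · have hperm : (y :: ((s ++ [u]).reverse ++ v :: t)).Perm (y :: (s ++ u :: v :: t)) := by
        refine List.Perm.cons _ ?_
        simpa using (List.reverse_perm (s ++ [u])).append_right (v :: t)
      rw [hperm.nodup_iff]
      exact List.nodup_cons.2 ⟨hy, hn⟩
    · intro x
      simp only [List.mem_cons, List.mem_append, List.mem_reverse, Set.mem_insert_iff,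
        Set.mem_ofPred_eq, List.not_mem_nil]
      tauto
end

section
/- Let G be a simple graph, let C be a cycle of G of length l(C), and let y ∈ V(G) − V(C). Suppose d(y, V(C)) ≥ l(C)/2. Then either the induced subgraph G[V(C) ∪ {y}] is Hamiltonian, or l(C) is even and there is a listing x1, …, x_{l(C)} of the vertices of C in cyclic order along C such that N(y) ∩ V(C) = {x_{2i−1} : 1 ≤ i ≤ l(C)/2}. -/
open SimpleGraph

variable {V : Type*}

/-- A graph is Hamiltonian if it has a Hamiltonian cycle. -/
def Hamilt {α : Type*} (H : SimpleGraph α) : Prop :=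
  ∃ (a : α) (c : H.Walk a a), c.IsCycle ∧ ∀ x, x ∈ c.support

/-- A path on at least two vertices whose ends are both adjacent to an outside vertex `y` closes up
to a cycle through `y`. -/
theorem SimpleGraph.Walk.IsPath.isCycle_cons_concat {G : SimpleGraph V} {u v y : V}
    {p : G.Walk v u} (hp : p.IsPath) (hvu : v ≠ u) (hy : y ∉ p.support) (hv : G.Adj y v)
    (hu : G.Adj u y) : (Walk.cons hv (p.concat hu)).IsCycle := by
  rw [Walk.cons_isCycle_iff]
  refine ⟨hp.concat hy hu, ?_⟩
  rw [Walk.edges_concat, List.concat_eq_append, List.mem_append, not_or]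
  refine ⟨fun h => hy (p.fst_mem_support_of_mem_edges h), ?_⟩
  have := hu.ne
  simp only [List.mem_singleton, Sym2.eq_iff]
  grind

/-- A cycle of `G` whose vertex set is `s` makes `G.induce s` Hamiltonian. -/
theorem SimpleGraph.Walk.IsCycle.hamilt_induce {G : SimpleGraph V} {a : V} {c : G.Walk a a}
    (hc : c.IsCycle) {s : Set V} (hs : ∀ x, x ∈ c.support ↔ x ∈ s) : Hamilt (G.induce s) := by
  refine ⟨_, c.induce s fun x hx => (hs x).1 hx, Walk.IsCycle.of_map (f := (Embedding.induce s).toHom)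
    (by rwa [Walk.map_induce]), fun x => ?_⟩
  simp [Walk.support_induce, hs]

/-- Opening a cycle at the edge between its `i`-th and `(i + 1)`-st vertices gives a path. -/
theorem SimpleGraph.Walk.IsCycle.exists_isPath_getVert_succ {G : SimpleGraph V} {a : V}
    {c : G.Walk a a} (hc : c.IsCycle) {i : ℕ} (hi : i < c.length) :
    ∃ p : G.Walk (c.getVert (i + 1)) (c.getVert i),
      p.IsPath ∧ ∀ x, x ∈ p.support ↔ x ∈ c.support := by
  have hsupp : ((c.drop (i + 1)).append (c.take i)).support =
      c.support.tail.drop i ++ c.support.tail.take i := by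
    rw [Walk.support_append, Walk.drop_support_eq_support_drop_min, Walk.support_take,
      min_eq_left hi, List.drop_tail]
    congr 1
    cases c.support <;> simp
  refine ⟨(c.drop (i + 1)).append (c.take i), Walk.IsPath.mk' ?_, fun x => ?_⟩
  · rw [hsupp]
    exact (List.perm_append_comm.trans (by rw [List.take_append_drop])).nodup_iff.2 hc.support_nodup
  · rw [hsupp, List.mem_append, or_comm, ← List.mem_append, List.take_append_drop]
    refine ⟨List.mem_of_mem_tail, fun hx => ?_⟩
    rw [← Walk.cons_tail_support c, List.mem_cons] at hx
    rcases hx with rfl | hx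
    · exact Walk.end_mem_tail_support hc.not_nil
    · exact hx

/-- A cycle with two consecutive neighbours of an outside vertex `y` extends to a cycle
through `y`. -/
theorem SimpleGraph.Walk.IsCycle.hamilt_induce_insert {G : SimpleGraph V} {a y : V}
    {c : G.Walk a a} (hc : c.IsCycle) (hy : y ∉ c.support) {i : ℕ} (hi : i < c.length)
    (h₀ : G.Adj y (c.getVert i)) (h₁ : G.Adj y (c.getVert (i + 1))) :
    Hamilt (G.induce (insert y {v | v ∈ c.support})) := by
  obtain ⟨p, hp, hmem⟩ := hc.exists_isPath_getVert_succ hi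
  refine (hp.isCycle_cons_concat (c.adj_getVert_succ hi).ne' (by rwa [hmem]) h₁
    h₀.symm).hamilt_induce fun x => ?_
  simp [Walk.support_concat, hmem, or_comm]

/-- The number of neighbours on a closed walk is at most the number of positions occupied by
neighbours. -/
theorem dOn_support_le_card {G : SimpleGraph V} {a : V} (c : G.Walk a a) (hc : ¬ c.Nil) (y : V)
    [DecidablePred fun i => G.Adj y (c.getVert i)] :
    dOn G y {v | v ∈ c.support} ≤
      ((Finset.range c.length).filter fun i => G.Adj y (c.getVert i)).card := by
  classical
  have hsub : {v | v ∈ c.support ∧ G.Adj y v} ⊆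
      ((((Finset.range c.length).filter fun i => G.Adj y (c.getVert i)).image c.getVert :
        Finset V) : Set V) := by
    rintro v ⟨hv, hyv⟩
    obtain ⟨i, rfl, hi⟩ := Walk.mem_support_iff_exists_getVert.1 hv
    have hpos : 0 < c.length := Walk.not_nil_iff_lt_length.1 hc
    simp only [Finset.coe_image, Finset.coe_filter, Finset.mem_range, Set.mem_image,
      Set.mem_ofPred_eq]
    rcases hi.lt_or_eq with hi | rfl
    · exact ⟨i, ⟨hi, hyv⟩, rfl⟩
    · refine ⟨0, ⟨hpos, ?_⟩, ?_⟩ <;> simp_all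
  have h := Set.ncard_le_ncard hsub (Finset.finite_toSet _)
  rw [Set.ncard_coe_finset] at h
  exact h.trans Finset.card_image_le

/-- If a predicate on `{0, …, n}` agrees at `0` and `n`, never holds at two consecutive indices and
holds on at least half of `{0, …, n - 1}`, then it alternates. -/
theorem iff_even_iff_of_le_two_mul_card_filter {n : ℕ} {b : ℕ → Prop} [DecidablePred b]
    (hn : b n ↔ b 0) (hcons : ∀ i < n, b i → ¬ b (i + 1))
    (hcard : n ≤ 2 * ((Finset.range n).filter b).card) : ∀ i ≤ n, b i ↔ (Even i ↔ b 0) := by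
  have hshift : ((Finset.range n).filter fun i => b (i + 1)).card =
      ((Finset.range n).filter b).card := by
    have h₁ := Finset.sum_range_succ (fun i => if b i then 1 else 0) n
    have h₂ := Finset.sum_range_succ' (fun i => if b i then 1 else 0) n
    simp only [Finset.card_filter, hn] at h₁ h₂ ⊢
    omega
  have hdisj : Disjoint ((Finset.range n).filter b)
      ((Finset.range n).filter fun i => b (i + 1)) := by
    rw [Finset.disjoint_filter]
    exact fun i hi => hcons i (Finset.mem_range.1 hi)
  have hunion : (Finset.range n).filter b ∪ ((Finset.range n).filter fun i => b (i + 1)) =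
      Finset.range n := by
    apply Finset.eq_of_subset_of_card_le
    · exact Finset.union_subset (Finset.filter_subset _ _) (Finset.filter_subset _ _)
    · rw [Finset.card_union_of_disjoint hdisj, hshift, Finset.card_range]
      omega
  have hstep : ∀ i < n, (b (i + 1) ↔ ¬ b i) := by
    intro i hi
    have := hunion.symm ▸ Finset.mem_range.2 hi
    simp only [Finset.mem_union, Finset.mem_filter, Finset.mem_range, hi, true_and] at this
    have := hcons i hi
    tauto
  intro i
  induction i with
  | zero => simp
  | succ i ih =>
    intro hi
    rw [hstep i hi, ih (by omega), Nat.even_add_one]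
    tauto

/-- Lemma 2.2, graph case: if `C` is a cycle of `G`, `y ∉ V(C)` and
`d(y, V(C)) ≥ l(C)/2`, then either `G[V(C) ∪ {y}]` is Hamiltonian, or `l(C)` is even and
there is a listing of the vertices of `C` in cyclic order (a rotation of
`c.support.tail`) whose odd-numbered members (even 0-based indices) are exactly the
neighbours of `y` on `C`.  Here `c.support.tail` lists the vertices of the cycle once,
in order along `C`, and `l(C) = c.support.tail.length`. -/
theorem stmt_8 {V : Type*} (G : SimpleGraph V) {a : V}
    (c : G.Walk a a) (hc : c.IsCycle) (y : V) (hy : y ∉ c.support)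
    (hd : c.support.tail.length ≤ 2 * dOn G y {v | v ∈ c.support}) :
    Hamilt (G.induce (insert y {v | v ∈ c.support})) ∨
    (Even c.support.tail.length ∧
      ∃ l : List V, l.IsRotated c.support.tail ∧
        ∀ i < l.length, (G.Adj y (l.getD i y) ↔ Even i)) := by
  classical
  by_cases hex : ∃ i < c.length, G.Adj y (c.getVert i) ∧ G.Adj y (c.getVert (i + 1))
  · obtain ⟨i, hi, h₀, h₁⟩ := hex
    exact Or.inl (hc.hamilt_induce_insert hy hi h₀ h₁)
  right
  push Not at hex
  have hlen : c.support.tail.length = c.length := by simp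
  have hpos : 0 < c.length := Walk.not_nil_iff_lt_length.1 hc.not_nil
  have halt := iff_even_iff_of_le_two_mul_card_filter
    (n := c.length) (b := fun i => G.Adj y (c.getVert i)) (by simp) hex
    (by have := dOn_support_le_card c hc.not_nil y; omega)
  have heven : Even c.length := by
    have := halt c.length le_rfl
    simp only [Walk.getVert_length, Walk.getVert_zero] at this
    tauto
  have hget : ∀ i (hi : i < c.support.tail.length), c.support.tail[i] = c.getVert (i + 1) := by
    intro i hi
    rw [List.getElem_tail, Walk.support_getElem_eq_getVert]
  refine ⟨hlen ▸ heven, ?_⟩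
  by_cases hb : G.Adj y (c.getVert 0)
  · refine ⟨c.support.tail.rotate (c.length - 1), List.IsRotated.symm ⟨_, rfl⟩, fun i hi => ?_⟩
    have hi' : i < c.length := by simpa using hi
    rw [List.getD_eq_getElem _ _ hi, List.getElem_rotate, hget]
    rcases Nat.eq_zero_or_pos i with rfl | h
    · rw [hlen, Nat.zero_add, Nat.mod_eq_of_lt (by omega), Nat.sub_add_cancel hpos]
      simpa using hb
    · rw [hlen, show i + (c.length - 1) = i - 1 + c.length by omega, Nat.add_mod_right,
        Nat.mod_eq_of_lt (by omega), Nat.sub_add_cancel h]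
      have := halt i hi'.le
      tauto
  · refine ⟨c.support.tail, List.IsRotated.refl _, fun i hi => ?_⟩
    rw [List.getD_eq_getElem _ _ hi, hget]
    have := halt (i + 1) (by omega)
    rw [Nat.even_add_one] at this
    tauto
end

section
/- Let G be a simple graph, let x_t be a vertex of G, and let P = x_t x_{t−1} … x_1 be a longest path of G starting at x_t. Let c > t/2 be a real number. Suppose that every vertex v of G which is the terminal vertex of some longest path of G starting at x_t satisfies d_G(v) ≥ c. Then there exists an index r with r ≥ c + 1 such that for every i ∈ {1, 2, …, r−1}: N_G(x_i) ⊆ {x_1, x_2, …, x_r}, the induced subgraph G[V(P)] has a Hamiltonian path from x_t to x_i containing the subpath x_t x_{t−1} … x_r, and d_G(x_i) ≥ c. Moreover, if t > r then x_r is a cut vertex of G. -/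
open SimpleGraph

variable {V : Type*}

/-- `v` is a cut vertex of `G`: some two vertices distinct from `v` are connected in `G`
but not in `G - v`. -/
def IsCutVertex (G : SimpleGraph V) (v : V) : Prop :=
  ∃ a b, ∃ (ha : a ≠ v) (hb : b ≠ v), G.Reachable a b ∧
    ¬ (G.induce {u | u ≠ v}).Reachable ⟨a, ha⟩ ⟨b, hb⟩

open Classical in
/-- If no two consecutive entries `a`, `b` of `x :: l` satisfy `P a` and `Q b`, and `Q x` fails,
then `P` and `Q` hold at most `l.length + 1` times in total. -/
theorem countP_add_countP_le_of_head {α : Type*} (P Q : α → Prop) (x : α) (l : List α)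
    (h : (x :: l).IsChain fun a b => ¬ (P a ∧ Q b)) (hx : ¬ Q x) :
    (x :: l).countP (P ·) + (x :: l).countP (Q ·) ≤ l.length + 1 := by
  suffices h' : (x :: l).countP (P ·) + l.countP (Q ·) ≤ l.length + 1 by
    simpa [List.countP_cons (p := fun y => decide (Q y)), hx] using h'
  clear hx
  induction l generalizing x with
  | nil => exact (List.countP_le_length).trans_eq rfl
  | cons y l ih =>
    rw [List.isChain_cons_cons] at h
    have := ih y h.2
    have hxy := h.1
    simp only [List.countP_cons, List.length_cons] at this ⊢
    by_cases hP : P x <;> by_cases hQ : Q y <;> simp_all <;> omega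

open Classical in
theorem countP_add_countP_le_of_getLast {α : Type*} (P Q : α → Prop) (x : α) (l : List α)
    (h : (l ++ [x]).IsChain fun a b => ¬ (P a ∧ Q b)) (hx : ¬ P x) :
    (l ++ [x]).countP (P ·) + (l ++ [x]).countP (Q ·) ≤ l.length + 1 := by
  have h' : (x :: l.reverse).IsChain fun a b => ¬ (Q a ∧ P b) := by
    rw [← List.reverse_concat', List.isChain_reverse]
    simpa only [and_comm] using h
  have := countP_add_countP_le_of_head Q P x l.reverse h' hx
  rw [← List.reverse_concat', List.countP_reverse, List.countP_reverse, List.length_reverse] at this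
  omega

theorem exists_append_cons_cons_of_not_isChain {α : Type*} {R : α → α → Prop} {l : List α}
    (h : ¬ l.IsChain R) : ∃ a b l₁ l₂, l = l₁ ++ a :: b :: l₂ ∧ ¬ R a b := by
  rw [List.isChain_iff_forall_rel_of_append_cons_cons] at h
  push Not at h
  exact h

theorem isChain_adj_reverse {G : SimpleGraph V} {l : List V} :
    l.reverse.IsChain G.Adj ↔ l.IsChain G.Adj := by
  simp only [List.isChain_reverse, G.adj_comm]

open Classical in
/-- Two disjoint paths whose facing ends have large degree sum can be merged into a single path
keeping the two outer ends. -/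
theorem exists_isChain_merge (G : SimpleGraph V) (B C : List V) (a e : V)
    (hX : (B ++ [a]).IsChain G.Adj) (hY : (e :: C).IsChain G.Adj)
    (hdeg : ((B ++ [a]) ++ e :: C).length <
      ((B ++ [a]) ++ e :: C).countP (G.Adj a ·) + ((B ++ [a]) ++ e :: C).countP (G.Adj e ·)) :
    ∃ Z : List V, Z.IsChain G.Adj ∧ Z.Perm ((B ++ [a]) ++ e :: C) ∧
      Z.head? = (B ++ [a]).head? ∧ Z.getLast? = (e :: C).getLast? := by
  by_cases h₁ : (B ++ [a]).IsChain fun p q => ¬ (G.Adj a p ∧ G.Adj e q)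
  · by_cases h₂ : (e :: C).IsChain fun p q => ¬ (G.Adj a p ∧ G.Adj e q)
    · have k₁ := countP_add_countP_le_of_getLast _ _ _ _ h₁ (G.loopless.irrefl a)
      have k₂ := countP_add_countP_le_of_head _ _ _ _ h₂ (G.loopless.irrefl e)
      simp only [List.countP_append, List.length_append, List.length_cons, List.length_nil]
        at hdeg k₁ k₂
      omega
    · obtain ⟨p, q, l₁, l₂, hl, hpq⟩ := exists_append_cons_cons_of_not_isChain h₂
      obtain ⟨hp, hq⟩ := not_not.1 hpq
      rw [hl, List.isChain_append_cons_cons] at hY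
      have hrev : (l₁ ++ [p]).reverse = p :: l₁.reverse := by simp
      have hlast : (l₁ ++ [p]).reverse.getLast? = some e := by
        rw [List.getLast?_reverse]
        cases l₁ <;> simp_all
      refine ⟨(B ++ [a]) ++ ((l₁ ++ [p]).reverse ++ q :: l₂), ?_, ?_, ?_, ?_⟩
      · refine List.isChain_append.2 ⟨hX, List.isChain_append.2
          ⟨isChain_adj_reverse.2 hY.1, hY.2.2, ?_⟩, ?_⟩
        · rw [hlast]; simpa using hq
        · simpa using hp
      · rw [hl]
        refine List.Perm.append_left _ ?_
        have : l₁ ++ p :: q :: l₂ = (l₁ ++ [p]) ++ q :: l₂ := by simp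
        rw [this]
        exact (List.reverse_perm _).append_right _
      · cases B <;> simp
      · rw [hl]; simp [List.getLast?_append, List.getLast?_cons]
  · obtain ⟨p, q, l₁, l₂, hl, hpq⟩ := exists_append_cons_cons_of_not_isChain h₁
    obtain ⟨hp, hq⟩ := not_not.1 hpq
    rw [hl, List.isChain_append_cons_cons] at hX
    have hlast : (q :: l₂).getLast? = some a := by
      have := congrArg List.getLast? hl
      simpa [List.getLast?_append, List.getLast?_cons] using this.symm
    refine ⟨(l₁ ++ [p]) ++ ((q :: l₂).reverse ++ e :: C), ?_, ?_, ?_, ?_⟩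
    · refine List.isChain_append.2 ⟨hX.1, List.isChain_append.2
        ⟨isChain_adj_reverse.2 hX.2.2, hY, ?_⟩, ?_⟩
      · simpa using hq.symm
      · rw [List.head?_append, List.head?_reverse, hlast]
        simpa using hp.symm
    · rw [hl]
      have : l₁ ++ p :: q :: l₂ ++ e :: C = (l₁ ++ [p]) ++ ((q :: l₂) ++ e :: C) := by simp
      rw [this]
      exact List.Perm.append_left _ ((List.reverse_perm _).append_right _)
    · rw [hl]; cases l₁ <;> simp
    · simp [List.getLast?_append, List.getLast?_cons]

/-- `z` is the last vertex of a path starting at `x` whose other vertices are those of `D`. -/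
def IsHamEnd (G : SimpleGraph V) (x : V) (D : List V) (z : V) : Prop :=
  ∃ S : List V, (S ++ [z]).Perm D ∧ (x :: (S ++ [z])).IsChain G.Adj

open Classical in
/-- If a cycle passes through `x` and the vertices of `D`, and all ends of Hamiltonian paths from
`x` have large degree, then every vertex of `D` is such an end. -/
theorem isHamEnd_of_cycle (G : SimpleGraph V) (x : V) (D S : List V) (hS : S.Perm D)
    (hch : (x :: S).IsChain G.Adj) (hlast : ∀ z ∈ S.getLast?, G.Adj z x)
    (hdeg : ∀ z, IsHamEnd G x D z → D.length + 1 < 2 * (x :: D).countP (G.Adj z ·)) :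
    ∀ z ∈ D, IsHamEnd G x D z := by
  suffices h : ∀ B C, S = B ++ C → ∀ z ∈ B, IsHamEnd G x D z from fun z hz =>
    h S [] (by simp) z (hS.mem_iff.2 hz)
  intro B
  induction B using List.reverseRecOn with
  | nil => simp
  | append_singleton B b ih =>
    intro C hC z hz
    have ih' := ih (b :: C) (by simpa using hC)
    rcases List.mem_append.1 hz with hz | hz
    · exact ih' z hz
    obtain rfl : z = b := by simpa using hz
    rcases List.eq_nil_or_concat' C with rfl | ⟨C, e, rfl⟩
    · rw [List.append_nil] at hC
      exact ⟨B, hC ▸ hS, hC ▸ hch⟩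
    have he : IsHamEnd G x D e :=
      ⟨B ++ [z] ++ C, by simpa [hC] using hS, by simpa [hC] using hch⟩
    rcases List.eq_nil_or_concat' B with rfl | ⟨B, a, rfl⟩
    · refine ⟨(C ++ [e]).reverse, ?_, ?_⟩
      · refine List.Perm.trans ?_ hS
        rw [hC]
        simpa using List.reverse_perm (z :: (C ++ [e]))
      · have h' : S.reverse.IsChain G.Adj := isChain_adj_reverse.2 hch.tail
        have hex : G.Adj e x := hlast e (by simp [hC, List.getLast?_append, List.getLast?_cons])
        simp only [hC] at h'
        simp at h' ⊢
        exact ⟨hex.symm, h'⟩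
    have ha : IsHamEnd G x D a := ih' a (by simp)
    have hperm : ((x :: B ++ [a]) ++ e :: (C.reverse ++ [z])).Perm (x :: D) := by
      refine List.Perm.trans ?_ (hS.cons x)
      rw [hC]
      have := (List.reverse_perm (z :: (C ++ [e]))).append_left (x :: B ++ [a])
      simpa using this
    have hch' : ((x :: B ++ [a]) ++ (z :: (C ++ [e]))).IsChain G.Adj := by
      simpa [hC] using hch
    obtain ⟨hc₁, hc₂, -⟩ := List.isChain_append.1 hch'
    obtain ⟨Z, hZ, hZp, hZh, hZl⟩ := exists_isChain_merge G (x :: B) (C.reverse ++ [z]) a e hc₁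
      (by simpa using isChain_adj_reverse.2 hc₂) (by
        rw [hperm.length_eq, hperm.countP_eq, hperm.countP_eq, List.length_cons]
        have := hdeg a ha
        have := hdeg e he
        omega)
    rcases Z with _ | ⟨y, Z⟩
    · simp at hZh
    obtain rfl : y = x := by simpa using hZh
    have hZp' : Z.Perm D := (hZp.trans hperm).cons_inv
    rcases List.eq_nil_or_concat' Z with rfl | ⟨Z, u, rfl⟩
    · have := hS.trans hZp'.symm
      simp [hC] at this
    obtain rfl : u = z := by
      simpa [List.getLast?_append, List.getLast?_cons] using hZl
    exact ⟨Z, hZp', hZ⟩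

open Classical in
theorem dOn_univ_le_countP (G : SimpleGraph V) (z : V) (l : List V)
    (h : ∀ y, G.Adj z y → y ∈ l) : dOn G z Set.univ ≤ l.countP (G.Adj z ·) := by
  rw [List.countP_eq_length_filter]
  refine le_trans ?_ (List.toFinset_card_le _)
  rw [dOn, ← Nat.card_eq_finsetCard]
  exact Nat.card_le_card_of_injective
    (fun y => (⟨y.1, by simpa using ⟨h _ y.2.2, y.2.2⟩⟩ :
      (l.filter (G.Adj z ·)).toFinset))
    fun _ _ hy => Subtype.ext (congrArg (fun w => w.1) hy)

theorem exists_walk_of_isChain (G : SimpleGraph V) (l : List V) (u v : V)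
    (hc : l.IsChain G.Adj) (hu : l.head? = some u) (hv : l.getLast? = some v) :
    ∃ q : G.Walk u v, q.support = l := by
  have hne : l ≠ [] := by rintro rfl; simp at hu
  obtain rfl : l.head hne = u := by simpa [List.head?_eq_some_head hne] using hu
  obtain rfl : l.getLast hne = v := by simpa [List.getLast?_eq_some_getLast hne] using hv
  exact ⟨Walk.ofSupport l hne hc, Walk.support_ofSupport hne hc⟩

/-- A vertex separating a set closed under adjacency from the rest is a cut vertex. -/
theorem isCutVertex_of_closed (G : SimpleGraph V) {x a b : V} (D : Set V) (hb : b ∈ D)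
    (ha : a ∉ D) (hax : a ≠ x) (hbx : b ≠ x) (hab : G.Reachable a b)
    (hD : ∀ u ∈ D, ∀ v, G.Adj u v → v = x ∨ v ∈ D) : IsCutVertex G x := by
  refine ⟨a, b, hax, hbx, hab, fun ⟨q⟩ => ?_⟩
  have key : ∀ {s t : {u | u ≠ x}}, (G.induce {u | u ≠ x}).Walk s t → t.1 ∈ D → s.1 ∈ D := by
    intro s t q ht
    induction q with
    | nil => exact ht
    | @cons u _ _ h _ ih => exact (hD _ (ih ht) _ h.symm).resolve_left u.2
  exact ha (key q hb)


/-- Lemma 2.4: let `P = x_t x_{t-1} … x_1` be a longest path of `G`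
starting at `x_t` (so `p.support = [x_t, …, x_1]`, `t = p.support.length`, and
`x_i = p.support.reverse.getD (i-1) _`), and let `c > t/2` be a real number such that
every terminal vertex of a longest path of `G` starting at `x_t` has degree `≥ c`.
Then there is `r ≥ c + 1` such that for all `1 ≤ i ≤ r - 1`: `N(x_i) ⊆ {x_1, …, x_r}`,
`G[V(P)]` has a Hamiltonian path from `x_t` to `x_i` containing `x_t x_{t-1} … x_r`
(i.e. a path of `G` with vertex set `V(P)` having `p.support.take (t - r + 1)` as a
prefix), and `d_G(x_i) ≥ c`; moreover if `t > r` then `x_r` is a cut vertex of `G`. -/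
theorem stmt_11 {V : Type*} [Fintype V] (G : SimpleGraph V)
    {xt w : V} (p : G.Walk xt w) (hp : p.IsPath)
    (hlong : ∀ (z : V) (q : G.Walk xt z), q.IsPath → q.length ≤ p.length)
    (c : ℝ) (hc : (p.support.length : ℝ) / 2 < c)
    (hend : ∀ (z : V) (q : G.Walk xt z), q.IsPath → q.length = p.length →
      c ≤ (dOn G z Set.univ : ℝ)) :
    ∃ r : ℕ, c + 1 ≤ (r : ℝ) ∧ r ≤ p.support.length ∧
      (∀ i : ℕ, 1 ≤ i → i < r →
        (∀ z : V, G.Adj (p.support.reverse.getD (i - 1) xt) z →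
          z ∈ p.support.reverse.take r) ∧
        (∃ q : G.Walk xt (p.support.reverse.getD (i - 1) xt), q.IsPath ∧
          (∀ v, v ∈ q.support ↔ v ∈ p.support) ∧
          (p.support.take (p.support.length - r + 1)) <+: q.support) ∧
        c ≤ (dOn G (p.support.reverse.getD (i - 1) xt) Set.univ : ℝ)) ∧
      (r < p.support.length → IsCutVertex G (p.support.reverse.getD (r - 1) xt)) := by
  classical
  have hnd := hp.support_nodup
  have hlen := p.length_support
  have hchain := p.isChain_adj_support
  have hhead : p.support.head? = some xt := by
    rw [List.head?_eq_some_head p.support_ne_nil, p.head_support]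
  have hlastw : p.support.getLast? = some w := by
    rw [List.getLast?_eq_some_getLast p.support_ne_nil, p.getLast_support]
  generalize hl : p.support = l at *
  have hterm : ∀ m z, m.IsChain G.Adj → m.head? = some xt → m.getLast? = some z → m.Perm l →
      (∃ q : G.Walk xt z, q.IsPath ∧ q.support = m) ∧ (∀ y, G.Adj z y → y ∈ l) ∧
        c ≤ (dOn G z Set.univ : ℝ) := by
    intro m z hc' hh hz hm
    obtain ⟨q, rfl⟩ := exists_walk_of_isChain G m xt z hc' hh hz
    have hq : q.IsPath := Walk.IsPath.mk' (hm.nodup_iff.2 hnd)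
    have hql : q.length = p.length := by
      have := hm.length_eq
      rw [q.length_support] at this
      omega
    refine ⟨⟨q, hq, rfl⟩, fun y hy => ?_, hend z q hq hql⟩
    by_contra hyl
    have := hlong y (q.concat hy) (hq.concat (fun h => hyl (hm.mem_iff.1 h)) hy)
    rw [Walk.length_concat] at this
    omega
  have hcpos : 0 < c := lt_of_le_of_lt (by positivity) hc
  have hex : ∃ n, ∃ A x D S z, l = A ++ x :: D ∧ A.length = n ∧ (S ++ [z]).Perm D ∧
      (A ++ x :: (S ++ [z])).IsChain G.Adj ∧ G.Adj z x := by
    obtain ⟨-, hw, hcw⟩ := hterm l w hchain hhead hlastw (List.Perm.refl l)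
    have : 0 < l.countP (G.Adj w ·) := by
      have h₁ := dOn_univ_le_countP G w l hw
      have h₂ : (0 : ℝ) < dOn G w Set.univ := hcpos.trans_le hcw
      exact_mod_cast lt_of_lt_of_le (by exact_mod_cast h₂) h₁
    obtain ⟨x, hx, hwx⟩ := List.countP_pos_iff.1 this
    obtain ⟨A, D, hAD⟩ := List.append_of_mem hx
    replace hwx : G.Adj w x := by simpa using hwx
    rcases List.eq_nil_or_concat' D with rfl | ⟨S, z, rfl⟩
    · rw [hAD] at hlastw
      obtain rfl : x = w := by simpa using hlastw
      exact absurd hwx (G.loopless.irrefl x)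
    · rw [hAD] at hlastw
      obtain rfl : z = w := by simpa [List.getLast?_append, List.getLast?_cons] using hlastw
      exact ⟨_, A, x, _, S, z, hAD, rfl, List.Perm.refl _, hAD ▸ hchain, hwx⟩
  obtain ⟨A, x, D, S, z₀, hAD, hAn, hSD, hSc, hzx⟩ := Nat.find_spec hex
  have hmin := fun n => Nat.find_min hex (m := n)
  rw [← hAn] at hmin
  clear hAn
  have hAx : (A ++ [x]).IsChain G.Adj := (List.isChain_split.1 hSc).1
  have hheadA : ∀ T, (A ++ x :: T).head? = some xt := by
    intro T
    rw [hAD] at hhead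
    cases A <;> simpa using hhead
  have hfull : ∀ z, IsHamEnd G x D z →
      (∃ q : G.Walk xt z, q.IsPath ∧ ∃ T : List V, q.support = A ++ x :: T ∧ T.Perm D) ∧
        (∀ y, G.Adj z y → y ∈ x :: D) ∧ c ≤ (dOn G z Set.univ : ℝ) := by
    rintro z ⟨T, hT, hTc⟩
    have hch : (A ++ x :: (T ++ [z])).IsChain G.Adj := List.isChain_split.2 ⟨hAx, hTc⟩
    obtain ⟨⟨q, hq, hqs⟩, hy, hdeg⟩ := hterm (A ++ x :: (T ++ [z])) z hch (hheadA _)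
      (by simp [List.getLast?_append, List.getLast?_cons])
      (hAD ▸ (hT.cons x).append_left A)
    refine ⟨⟨q, hq, _, hqs, hT⟩, fun y hzy => ?_, hdeg⟩
    have hyl := hy y hzy
    rw [hAD] at hyl
    refine (List.mem_append.1 hyl).resolve_left fun hyA => ?_
    obtain ⟨A₁, A₂, rfl⟩ := List.append_of_mem hyA
    refine hmin A₁.length (by simp) ⟨A₁, y, A₂ ++ x :: D, A₂ ++ x :: T, z, by simp [hAD], rfl,
      ?_, by simpa using hch, hzy⟩
    simpa using (hT.cons x).append_left A₂
  have hlenl : l.length = A.length + (D.length + 1) := by rw [hAD]; simp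
  have hcount : ∀ z, IsHamEnd G x D z → c ≤ ((x :: D).countP (G.Adj z ·) : ℕ) := by
    intro z hz
    obtain ⟨-, hy, hdeg⟩ := hfull z hz
    exact hdeg.trans (by exact_mod_cast dOn_univ_le_countP G z _ hy)
  have hz₀ : IsHamEnd G x D z₀ := ⟨S, hSD, (List.isChain_split.1 hSc).2⟩
  have hall : ∀ z ∈ D, IsHamEnd G x D z := by
    refine isHamEnd_of_cycle G x D (S ++ [z₀]) hSD (List.isChain_split.1 hSc).2
      (by simpa using hzx) fun z hz => ?_
    have h₁ := hcount z hz
    have h₂ : (l.length : ℝ) < ((2 * (x :: D).countP (G.Adj z ·) : ℕ) : ℝ) := by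
      push_cast
      linarith
    have h₃ : l.length < 2 * (x :: D).countP (G.Adj z ·) := by exact_mod_cast h₂
    omega
  have hz₀D : z₀ ∈ D := hSD.mem_iff.1 (by simp)
  have hrev : l.reverse = D.reverse ++ x :: A.reverse := by rw [hAD]; simp
  have hndD : x ∉ D ∧ ∀ a ∈ A, a ≠ x ∧ a ∉ D := by
    rw [hAD] at hnd
    obtain ⟨-, hxD, hA⟩ := List.nodup_append.1 hnd
    exact ⟨(List.nodup_cons.1 hxD).1, fun a ha => ⟨hA a ha x List.mem_cons_self,
      fun h => hA a ha a (List.mem_cons_of_mem _ h) rfl⟩⟩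
  refine ⟨D.length + 1, ?_, by omega, fun i hi hir => ?_, fun hr => ?_⟩
  · have h₁ := hcount z₀ hz₀
    have h₂ : (x :: D).countP (G.Adj z₀ ·) ≤ D.length := by
      have := List.countP_lt_length_iff (l := x :: D) (p := (G.Adj z₀ ·)) |>.2
        ⟨z₀, List.mem_cons_of_mem _ hz₀D, by simp⟩
      simpa using Nat.lt_succ_iff.1 this
    have h₃ : (((x :: D).countP (G.Adj z₀ ·) : ℕ) : ℝ) ≤ D.length := by exact_mod_cast h₂
    push_cast
    linarith
  · have hmem : l.reverse.getD (i - 1) xt ∈ D := by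
      have hi' : i - 1 < D.reverse.length := by rw [List.length_reverse]; omega
      rw [hrev, List.getD_append _ _ _ _ hi', List.getD_eq_getElem _ _ hi']
      exact List.mem_reverse.1 (List.getElem_mem _)
    obtain ⟨⟨q, hq, T, hqs, hT⟩, hy, hdeg⟩ := hfull _ (hall _ hmem)
    refine ⟨fun z hz => ?_, ⟨q, hq, fun v => ?_, ?_⟩, hdeg⟩
    · have : l.reverse.take (D.length + 1) = D.reverse ++ [x] := by
        rw [hrev, List.take_append]
        simp
      rw [this]
      simpa [or_comm] using hy z hz
    · rw [hqs, hAD]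
      exact ((hT.cons x).append_left A).mem_iff
    · have : l.length - (D.length + 1) + 1 = A.length + 1 := by omega
      rw [this, hqs, hAD, List.take_append, List.take_of_length_le (Nat.le_succ _)]
      simp
  · have hx : l.reverse.getD (D.length + 1 - 1) xt = x := by
      rw [hrev, List.getD_append_right _ _ _ _ (by simp)]
      simp
    rw [hx]
    have hxtA : xt ∈ A := by
      rw [hAD] at hhead
      cases A with
      | nil => simp at hlenl; omega
      | cons a A => simp at hhead; simp [hhead]
    refine isCutVertex_of_closed G {v | v ∈ D} hz₀D (hndD.2 xt hxtA).2 (hndD.2 xt hxtA).1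
      (fun h => hndD.1 (h ▸ hz₀D)) ?_ fun u hu v huv => ?_
    · obtain ⟨⟨q, -⟩, -⟩ := hfull z₀ hz₀
      exact q.reachable
    · exact List.mem_cons.1 ((hfull u (hall u hu)).2.1 v huv)
end
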